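/- The following three conditions are equivalent: (a) there exist a real k×k symmetric positive definite matrix Γ and a real (n−k)×(n−k) symmetric positive definite matrix Δ with Ω = XΓXᵀ + ZΔZᵀ; (b) XᵀΩZ = 0; (c) XᵀΩ⁻¹Z = 0. -/

import Mathlib

open Matrix

lemma aux_inj {n k : ℕ} (X : Matrix (Fin n) (Fin k) ℝ) (hX : X.rank = k) :
    Function.Injective X.mulVec := by
  rw [Matrix.mulVec_injective_iff, linearIndependent_iff_card_eq_finrank_span]
  rw [Matrix.rank_eq_finrank_span_cols] at hX
  simpa [Set.finrank] using hX.symm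

lemma aux_gram {n k : ℕ} (X : Matrix (Fin n) (Fin k) ℝ) (hX : X.rank = k)
    (Ω : Matrix (Fin n) (Fin n) ℝ) (hΩ : Ω.PosDef) : (Xᵀ * Ω * X).PosDef := by
  simpa using hΩ.conjTranspose_mul_mul_same (aux_inj X hX)

lemma aux_gram1 {n k : ℕ} (X : Matrix (Fin n) (Fin k) ℝ) (hX : X.rank = k) :
    (Xᵀ * X).PosDef := by
  simpa using aux_gram X hX 1 Matrix.PosDef.one

lemma aux_proj {n k : ℕ} (hn : k < n)
    (X : Matrix (Fin n) (Fin k) ℝ) (hX : X.rank = k)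
    (Z : Matrix (Fin n) (Fin (n - k)) ℝ) (hXZ : Xᵀ * Z = 0) (hZ : Z.rank = n - k) :
    X * (Xᵀ * X)⁻¹ * Xᵀ + Z * (Zᵀ * Z)⁻¹ * Zᵀ = 1 := by
  have hZX : Zᵀ * X = 0 := by simpa using congrArg Matrix.transpose hXZ
  have h1 : (Xᵀ * X)⁻¹ * (Xᵀ * X) = 1 :=
    Matrix.nonsing_inv_mul _ ((Matrix.isUnit_iff_isUnit_det _).1 (aux_gram1 X hX).isUnit)
  have h2 : (Zᵀ * Z)⁻¹ * (Zᵀ * Z) = 1 :=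
    Matrix.nonsing_inv_mul _ ((Matrix.isUnit_iff_isUnit_det _).1 (aux_gram1 Z hZ).isUnit)
  have hL : fromRows ((Xᵀ * X)⁻¹ * Xᵀ) ((Zᵀ * Z)⁻¹ * Zᵀ) * fromCols X Z = 1 := by
    rw [fromRows_mul_fromCols, Matrix.mul_assoc, Matrix.mul_assoc, Matrix.mul_assoc,
      Matrix.mul_assoc, hXZ, hZX, h1, h2]
    simp
  have hR := (Matrix.mul_eq_one_comm_of_card_eq _ _ _ (by simp; omega)).1 hL
  rw [fromCols_mul_fromRows] at hR
  simpa [Matrix.mul_assoc] using hR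

lemma aux_bc {n k : ℕ} (hn : k < n)
    (X : Matrix (Fin n) (Fin k) ℝ) (hX : X.rank = k)
    (Z : Matrix (Fin n) (Fin (n - k)) ℝ) (hXZ : Xᵀ * Z = 0) (hZ : Z.rank = n - k)
    (Ω : Matrix (Fin n) (Fin n) ℝ) (hΩ : Ω.PosDef) (h : Xᵀ * Ω * Z = 0) :
    Xᵀ * Ω⁻¹ * Z = 0 := by
  have hP := aux_proj hn X hX Z hXZ hZ
  have hA := (aux_gram1 X hX).inv.isUnit
  have hB := (aux_gram X hX Ω hΩ).isUnit
  have hO : Ω * Ω⁻¹ = 1 :=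
    Matrix.mul_nonsing_inv _ ((Matrix.isUnit_iff_isUnit_det _).1 hΩ.isUnit)
  have e1 : Xᵀ * Ω = (Xᵀ * Ω * X) * (Xᵀ * X)⁻¹ * Xᵀ := by
    calc Xᵀ * Ω = Xᵀ * Ω * (X * (Xᵀ * X)⁻¹ * Xᵀ + Z * (Zᵀ * Z)⁻¹ * Zᵀ) := by rw [hP, Matrix.mul_one]
      _ = (Xᵀ * Ω * X) * (Xᵀ * X)⁻¹ * Xᵀ + (Xᵀ * Ω * Z) * (Zᵀ * Z)⁻¹ * Zᵀ := by
        simp only [Matrix.mul_add, Matrix.mul_assoc]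
      _ = _ := by rw [h]; simp
  have e2 : ((Xᵀ * Ω * X) * (Xᵀ * X)⁻¹) * (Xᵀ * Ω⁻¹ * Z) = 0 := by
    calc _ = ((Xᵀ * Ω * X) * (Xᵀ * X)⁻¹ * Xᵀ) * Ω⁻¹ * Z := by simp only [Matrix.mul_assoc]
      _ = Xᵀ * (Ω * Ω⁻¹) * Z := by rw [← e1]; simp only [Matrix.mul_assoc]
      _ = 0 := by rw [hO, Matrix.mul_one, hXZ]
  have hu := (Matrix.isUnit_iff_isUnit_det _).1 (hB.mul hA)
  have e3 := congrArg (fun M => ((Xᵀ * Ω * X) * (Xᵀ * X)⁻¹)⁻¹ * M) e2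
  simp only [← Matrix.mul_assoc _ _ (Xᵀ * Ω⁻¹ * Z)] at e3
  rwa [Matrix.nonsing_inv_mul _ hu, Matrix.one_mul, Matrix.mul_zero] at e3

lemma aux_pd {n k : ℕ} (X : Matrix (Fin n) (Fin k) ℝ) (hX : X.rank = k)
    (Ω : Matrix (Fin n) (Fin n) ℝ) (hΩ : Ω.PosDef) :
    ((Xᵀ * X)⁻¹ * (Xᵀ * Ω * X) * (Xᵀ * X)⁻¹).PosDef := by
  have hA := (aux_gram1 X hX).inv
  have := (aux_gram X hX Ω hΩ).conjTranspose_mul_mul_same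
    (Matrix.mulVec_injective_of_isUnit hA.isUnit)
  rwa [hA.isHermitian.eq] at this

theorem stmt_17 (n k : ℕ) (hk : 0 < k) (hn : k < n)
    (X : Matrix (Fin n) (Fin k) ℝ) (hX : X.rank = k)
    (Z : Matrix (Fin n) (Fin (n - k)) ℝ) (hXZ : Xᵀ * Z = 0) (hZ : Z.rank = n - k)
    (Ω : Matrix (Fin n) (Fin n) ℝ) (hΩ : Ω.PosDef) :
    ((∃ (Γ : Matrix (Fin k) (Fin k) ℝ) (Δ : Matrix (Fin (n - k)) (Fin (n - k)) ℝ),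
        Γ.PosDef ∧ Δ.PosDef ∧ Ω = X * Γ * Xᵀ + Z * Δ * Zᵀ) ↔ Xᵀ * Ω * Z = 0) ∧
      (Xᵀ * Ω * Z = 0 ↔ Xᵀ * Ω⁻¹ * Z = 0) := by
  refine ⟨⟨?_, ?_⟩, aux_bc hn X hX Z hXZ hZ Ω hΩ, ?_⟩
  · rintro ⟨Γ, Δ, -, -, h⟩
    calc Xᵀ * Ω * Z = Xᵀ * X * Γ * (Xᵀ * Z) + (Xᵀ * Z) * Δ * Zᵀ * Z := by
          rw [h]; simp only [Matrix.mul_add, Matrix.add_mul, Matrix.mul_assoc]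
      _ = 0 := by rw [hXZ]; simp
  · intro h
    have hT : Ωᵀ = Ω := by simpa using hΩ.isHermitian.eq
    have h' : Zᵀ * Ω * X = 0 := by
      simpa [hT, Matrix.mul_assoc] using congrArg Matrix.transpose h
    have hP := aux_proj hn X hX Z hXZ hZ
    refine ⟨_, _, aux_pd X hX Ω hΩ, aux_pd Z hZ Ω hΩ, ?_⟩
    generalize (Xᵀ * X)⁻¹ = A at *
    generalize (Zᵀ * Z)⁻¹ = B at *
    calc Ω = (X * A * Xᵀ + Z * B * Zᵀ) * Ω * (X * A * Xᵀ + Z * B * Zᵀ) := by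
          rw [hP, one_mul, mul_one]
      _ = X * (A * (Xᵀ * Ω * X) * A) * Xᵀ + Z * (B * (Zᵀ * Ω * Z) * B) * Zᵀ
          + (X * A * (Xᵀ * Ω * Z) * B * Zᵀ + Z * B * (Zᵀ * Ω * X) * A * Xᵀ) := by
          simp only [Matrix.mul_add, Matrix.add_mul, Matrix.mul_assoc]; abel
      _ = _ := by rw [h, h']; simp
  · intro h
    have := aux_bc hn X hX Z hXZ hZ Ω⁻¹ hΩ.inv h
    rwa [Matrix.nonsing_inv_nonsing_inv _ ((Matrix.isUnit_iff_isUnit_det _).1 hΩ.isUnit)] at this
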